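/- Let P be a string of length m with run-length encoding rle(P) = ⟨(c_0,l_0),…,(c_{ρ-1},l_{ρ-1})⟩ with ρ ≥ 2, and let S be a string with run-length encoding of length at least j+1, for some j ≥ 0. Then there exists an index t with α_S(j) ≤ t ≤ β_S(j), t ≥ m−1, and S[t−m+1..t] = P (an occurrence of P ending inside the j-th run of S) if and only if all three of the following hold: (1) the prefix P[0..α_P(ρ−1)−1] of P of length α_P(ρ−1) is a suffix of S[0..α_S(j)−1]; (2) S[α_S(j)] = c_{ρ−1}; and (3) ℓ_S(j) ≥ l_{ρ−1}. Moreover, in that case the occurrence ends exactly at t = α_S(j) + l_{ρ−1} − 1. (This is case (b) of the paper's Lemma 3 for i = ρ, for the KMP automaton modified with a self-loop on the final state labeled P[m−1].) -/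

import Mathlib

/-- Decoding of a run-length encoding: concatenation of the runs. -/
def decodeRLE {α : Type*} (r : List (α × ℕ)) : List α :=
  r.foldr (fun p acc => List.replicate p.2 p.1 ++ acc) []

/-- `IsRLE r S` : `r` is the run-length encoding of `S`
    (all run lengths are ≥ 1, adjacent runs have distinct symbols, decoding gives `S`). -/
def IsRLE {α : Type*} (r : List (α × ℕ)) (S : List α) : Prop :=
  (∀ p ∈ r, 1 ≤ p.2) ∧ List.Chain' (fun p q => p.1 ≠ q.1) r ∧ decodeRLE r = S

/-- `rleStart r k` = α(k), the starting position of run `k` (sum of lengths of runs before `k`). -/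
def rleStart {α : Type*} (r : List (α × ℕ)) (k : ℕ) : ℕ :=
  ((r.take k).map Prod.snd).sum

theorem decodeRLE_append {α : Type*} (r s : List (α × ℕ)) :
    decodeRLE (r ++ s) = decodeRLE r ++ decodeRLE s := by
  induction r with
  | nil => rfl
  | cons p r ih =>
    change List.replicate p.2 p.1 ++ decodeRLE (r ++ s) =
      (List.replicate p.2 p.1 ++ decodeRLE r) ++ decodeRLE s
    rw [ih, List.append_assoc]

theorem decodeRLE_singleton {α : Type*} (p : α × ℕ) :
    decodeRLE [p] = List.replicate p.2 p.1 := by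
  simp [decodeRLE]

theorem length_decodeRLE {α : Type*} (r : List (α × ℕ)) :
    (decodeRLE r).length = (r.map Prod.snd).sum := by
  induction r with
  | nil => rfl
  | cons p r ih =>
    change (List.replicate p.2 p.1 ++ decodeRLE r).length = _
    simp [ih]

theorem getLast?_decodeRLE {α : Type*} (r : List (α × ℕ)) (h : ∀ p ∈ r, 1 ≤ p.2) :
    (decodeRLE r).getLast? = r.getLast?.map Prod.fst := by
  rcases List.eq_nil_or_concat r with rfl | ⟨r, p, rfl⟩
  · rfl
  · have hp : 1 ≤ p.2 := h p (by simp)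
    rw [List.concat_eq_append, decodeRLE_append, decodeRLE_singleton, List.getLast?_append]
    simp [List.getLast?_replicate, Nat.one_le_iff_ne_zero.mp hp]

/-- Splitting a string around its `k`-th run. -/
theorem IsRLE.split_at_run {α : Type*} {r : List (α × ℕ)} {S : List α} (h : IsRLE r S)
    (k : ℕ) (hk : k < r.length) :
    ∃ A B, S = A ++ List.replicate r[k].2 r[k].1 ++ B ∧ A.length = rleStart r k ∧
      A.getLast? ≠ some r[k].1 ∧ (0 < k → A ≠ []) ∧ (k = r.length - 1 → B = []) := by
  obtain ⟨h1, h2, rfl⟩ := h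
  have hpos : ∀ p ∈ r.take k, 1 ≤ p.2 := fun p hp => h1 p (List.mem_of_mem_take hp)
  have hlast := getLast?_decodeRLE (r.take k) hpos
  refine ⟨decodeRLE (r.take k), decodeRLE (r.drop (k + 1)), ?_, length_decodeRLE _, ?_, ?_, ?_⟩
  · rw [← decodeRLE_singleton, ← decodeRLE_append, ← decodeRLE_append]
    simp
  · rw [hlast]
    rcases k with _ | k
    · simp
    · have := List.isChain_iff_getElem.mp h2 k hk
      simpa [List.getLast?_take, List.getElem?_eq_getElem (show k < r.length by omega)] using this
  · intro h0 hnil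
    rw [hnil] at hlast
    have : r.take k ≠ [] := by
      simp only [ne_eq, List.take_eq_nil_iff, not_or]
      exact ⟨by omega, List.ne_nil_of_length_pos (by omega)⟩
    rw [List.getLast?_eq_some_getLast this] at hlast
    simp at hlast
  · intro h0
    rw [List.drop_eq_nil_of_le (by omega)]
    rfl

theorem suffix_take_iff {α : Type*} (P S : List α) (n : ℕ) (h1 : P.length ≤ n)
    (h2 : n ≤ S.length) :
    (S.drop (n - P.length)).take P.length = P ↔ P <:+ S.take n := by
  rw [List.suffix_iff_eq_drop, List.drop_take, List.length_take, min_eq_left h2,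
    Nat.sub_sub_self h1, eq_comm]

/-- A suffix relation between strings ending in maximal runs forces these runs to agree,
provided that the shorter string has at least two runs. -/
theorem eq_of_append_replicate_suffix {α : Type*} {Q A : List α} {c d : α}
    (hQ : Q ≠ []) (hQc : Q.getLast? ≠ some c) (hAd : A.getLast? ≠ some d) :
    ∀ {l k : ℕ}, 1 ≤ l → 1 ≤ k →
      Q ++ List.replicate l c <:+ A ++ List.replicate k d → d = c ∧ k = l ∧ Q <:+ A := by
  intro l
  induction l with
  | zero => intro k h; omega
  | succ l ih =>
    intro k _ hk h
    obtain ⟨k, rfl⟩ : ∃ k', k = k' + 1 := ⟨k - 1, by omega⟩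
    obtain ⟨T, hT⟩ := h
    simp only [List.replicate_succ', ← List.append_assoc] at hT
    obtain ⟨hT, hcd⟩ := List.append_inj' hT rfl
    obtain rfl : c = d := by simpa using hcd
    have hl := congrArg List.getLast? hT
    rcases Nat.eq_zero_or_pos l with rfl | hl0 <;> rcases Nat.eq_zero_or_pos k with rfl | hk0
    · exact ⟨rfl, rfl, T, by simpa using hT⟩
    · rw [List.getLast?_append (l' := List.replicate k c)] at hl
      simp [List.getLast?_replicate, hk0.ne', List.getLast?_append,
        List.getLast?_eq_some_getLast hQ] at hl
      simp [List.getLast?_eq_some_getLast hQ, hl] at hQc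
    · rw [List.getLast?_append (l' := List.replicate l c)] at hl
      simp [List.getLast?_replicate, hl0.ne'] at hl
      exact absurd hl.symm hAd
    · obtain ⟨_, h2, h3⟩ := ih hl0 hk0 ⟨T, by simpa using hT⟩
      exact ⟨rfl, by omega, h3⟩

theorem stmt_6 {α : Type*} [Fintype α] [Inhabited α] (P S : List α) (rP rS : List (α × ℕ))
    (hP : IsRLE rP P) (hS : IsRLE rS S)
    (hρ : 2 ≤ rP.length)
    (j : ℕ) (hj : j + 1 ≤ rS.length) :
    ((∃ t, rleStart rS j ≤ t ∧ t ≤ rleStart rS j + (rS[j]'(by omega)).2 - 1 ∧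
        P.length - 1 ≤ t ∧ (S.drop (t + 1 - P.length)).take P.length = P) ↔
      ((P.take (rleStart rP (rP.length - 1)) <:+ S.take (rleStart rS j)) ∧
       S.getD (rleStart rS j) default = (rP[rP.length - 1]'(by omega)).1 ∧
       (rP[rP.length - 1]'(by omega)).2 ≤ (rS[j]'(by omega)).2)) ∧
    (∀ t, rleStart rS j ≤ t → t ≤ rleStart rS j + (rS[j]'(by omega)).2 - 1 →
        P.length - 1 ≤ t → (S.drop (t + 1 - P.length)).take P.length = P →
        t = rleStart rS j + (rP[rP.length - 1]'(by omega)).2 - 1) := by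
  obtain ⟨Q, B', hPQ, hQl, hQc, hQ, hB'⟩ := hP.split_at_run (rP.length - 1) (by omega)
  obtain ⟨A, B, hSA, hAl, hAd, -, -⟩ := hS.split_at_run j (by omega)
  have hl1 := hP.1 _ (List.getElem_mem (show rP.length - 1 < rP.length by omega))
  have hL1 := hS.1 _ (List.getElem_mem (show j < rS.length by omega))
  rw [hB' rfl, List.append_nil] at hPQ
  replace hQ := hQ (by omega)
  rw [← hQl, ← hAl]
  generalize rP[rP.length - 1].1 = c at *
  generalize rP[rP.length - 1].2 = l at *
  generalize rS[j].1 = d at *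
  generalize rS[j].2 = L at *
  subst hPQ hSA
  have hPlen : (Q ++ List.replicate l c).length = Q.length + l := by simp
  have htake : ∀ k ≤ L, (A ++ List.replicate L d ++ B).take (A.length + k) =
      A ++ List.replicate k d := by
    intro k hk
    rw [List.append_assoc, List.take_length_add_append, List.take_append_of_le_length (by simpa),
      List.take_replicate, min_eq_left hk]
  have hend : ∀ t, A.length ≤ t → t ≤ A.length + L - 1 →
      (Q ++ List.replicate l c).length - 1 ≤ t →
      (((A ++ List.replicate L d ++ B).drop (t + 1 - (Q ++ List.replicate l c).length)).take
        (Q ++ List.replicate l c).length = Q ++ List.replicate l c ↔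
      Q ++ List.replicate l c <:+ A ++ List.replicate (t + 1 - A.length) d) := by
    intro t h1 h2 h3
    rw [suffix_take_iff _ _ _ (by omega) (by simp; omega), ← htake (t + 1 - A.length) (by omega),
      Nat.add_sub_cancel' (by omega)]
  have key : ∀ t, A.length ≤ t → t ≤ A.length + L - 1 →
      (Q ++ List.replicate l c).length - 1 ≤ t →
      ((A ++ List.replicate L d ++ B).drop (t + 1 - (Q ++ List.replicate l c).length)).take
        (Q ++ List.replicate l c).length = Q ++ List.replicate l c →
      d = c ∧ t + 1 - A.length = l ∧ Q <:+ A := fun t h1 h2 h3 h4 =>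
    eq_of_append_replicate_suffix hQ hQc hAd hl1 (by omega) ((hend t h1 h2 h3).mp h4)
  have hget : (A ++ List.replicate L d ++ B).getD A.length default = d := by
    have hL0 : 0 < L := hL1
    simp [List.getD_eq_getElem?_getD, List.append_assoc, hL0]
  have htQ : (Q ++ List.replicate l c).take Q.length = Q := by simp
  have htA : (A ++ List.replicate L d ++ B).take A.length = A := by simp
  rw [hget, htQ, htA]
  refine ⟨⟨?_, ?_⟩, ?_⟩
  · rintro ⟨t, h1, h2, h3, h4⟩
    obtain ⟨h5, h6, h7⟩ := key t h1 h2 h3 h4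
    exact ⟨h7, h5, by omega⟩
  · rintro ⟨hQA, rfl, hlL⟩
    have hlen := hQA.length_le
    refine ⟨A.length + l - 1, by omega, by omega, by omega, ?_⟩
    rw [hend _ (by omega) (by omega) (by omega),
      show A.length + l - 1 + 1 - A.length = l by omega]
    obtain ⟨T, rfl⟩ := hQA
    exact ⟨T, by simp⟩
  · intro t h1 h2 h3 h4
    obtain ⟨-, h6, -⟩ := key t h1 h2 h3 h4
    omega
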